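/- Let Markov-parameter data S_{q,q0,j}(w), S_{f,q}(w) for an index set Φ over a finite mode set Q be given, and suppose for some N > 0 that rank H_{Φ,N,N} = rank H_{Φ,N+1,N} = rank H_{Φ,N,N+1}. Then there exists an LSS realization (Σ_N, μ_N) of dimension rank H_{Φ,N,N} which is a (2N+1)-partial realization of the Markov data. -/

import Mathlib

open Matrix

section LssDefs

variable {Q Φ : Type*} {p m : ℕ}

/-- `A_w = A_{q_k} ⋯ A_{q_1}` for the word `w = q_1 ⋯ q_k`. -/
def wordProd {Q : Type*} {n : ℕ} (A : Q → Matrix (Fin n) (Fin n) ℝ) :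
    List Q → Matrix (Fin n) (Fin n) ℝ
  | [] => 1
  | q :: w => wordProd A w * A q

/-- Entry data of the Hankel matrix of the Markov-parameter data `(S1, S2)`:
`S1 q q0 z w = S_{q,q0,z}(w)` and `S2 f q w = S_{f,q}(w)`.  The column index `j` ranges
over `J_Φ = Φ ⊕ (Q × {1,…,m})`, the row block is indexed by `q' ∈ Q` (the enumeration of
`{1,…,pD}` as `Q × Fin p`) together with `r ∈ Fin p`. -/
def lssEntry (S1 : Q → Q → Fin m → List Q → Fin p → ℝ)
    (S2 : Φ → Q → List Q → Fin p → ℝ)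
    (j : Φ ⊕ Q × Fin m) (u : List Q) (q' : Q) (r : Fin p) : ℝ :=
  match j with
  | Sum.inl f => S2 f q' u r
  | Sum.inr (q, z) => S1 q' q z u r

/-- Span of the columns of the full Hankel matrix `H_Φ`. -/
def lssFullSpan (S1 : Q → Q → Fin m → List Q → Fin p → ℝ)
    (S2 : Φ → Q → List Q → Fin p → ℝ) : Submodule ℝ (List Q × Q × Fin p → ℝ) :=
  Submodule.span ℝ (Set.range fun wj : List Q × (Φ ⊕ Q × Fin m) =>
    fun vqr : List Q × Q × Fin p =>
      lssEntry S1 S2 wj.2 (wj.1 ++ vqr.1) vqr.2.1 vqr.2.2)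

/-- `rank H_{Φ,L,M}` : dimension of the span of the columns of the sub-Hankel matrix
whose rows are indexed by `(v,i)` with `|v| ≤ L` and whose columns are indexed by
`(w,j)` with `|w| ≤ M`. -/
noncomputable def lssHankelRank (S1 : Q → Q → Fin m → List Q → Fin p → ℝ)
    (S2 : Φ → Q → List Q → Fin p → ℝ) (L M : ℕ) : ℕ :=
  Module.finrank ℝ (Submodule.span ℝ
    (Set.range fun wj : {w : List Q // w.length ≤ M} × (Φ ⊕ Q × Fin m) =>
      fun vqr : {v : List Q // v.length ≤ L} × Q × Fin p =>
        lssEntry S1 S2 wj.2 (wj.1.1 ++ vqr.1.1) vqr.2.1 vqr.2.2))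

/-- `(Σ, μ)` is an `N`-partial LSS realization of the Markov-parameter data. -/
def IsLssPartialRealization (S1 : Q → Q → Fin m → List Q → Fin p → ℝ)
    (S2 : Φ → Q → List Q → Fin p → ℝ) (N : ℕ) {n : ℕ}
    (A : Q → Matrix (Fin n) (Fin n) ℝ) (B : Q → Matrix (Fin n) (Fin m) ℝ)
    (C : Q → Matrix (Fin p) (Fin n) ℝ) (μ : Φ → Fin n → ℝ) : Prop :=
  ∀ w : List Q, w.length ≤ N →
    (∀ (q q0 : Q) (z : Fin m),
      S1 q q0 z w = (C q).mulVec ((wordProd A w).mulVec (fun i => B q0 i z))) ∧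
    (∀ (f : Φ) (q : Q), S2 f q w = (C q).mulVec ((wordProd A w).mulVec (μ f)))

/-- `(Σ, μ)` is a complete LSS realization of the Markov-parameter data. -/
def IsLssRealization (S1 : Q → Q → Fin m → List Q → Fin p → ℝ)
    (S2 : Φ → Q → List Q → Fin p → ℝ) {n : ℕ}
    (A : Q → Matrix (Fin n) (Fin n) ℝ) (B : Q → Matrix (Fin n) (Fin m) ℝ)
    (C : Q → Matrix (Fin p) (Fin n) ℝ) (μ : Φ → Fin n → ℝ) : Prop :=
  ∀ w : List Q,
    (∀ (q q0 : Q) (z : Fin m),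
      S1 q q0 z w = (C q).mulVec ((wordProd A w).mulVec (fun i => B q0 i z))) ∧
    (∀ (f : Φ) (q : Q), S2 f q w = (C q).mulVec ((wordProd A w).mulVec (μ f)))

end LssDefs

section HankelColumns

variable {Q Φ : Type*} {p m : ℕ}

/-- The column of index `(w, j)` of the Hankel matrix, restricted to the rows `(v, i)` with
`|v| ≤ L`. -/
def hankelCol (S1 : Q → Q → Fin m → List Q → Fin p → ℝ)
    (S2 : Φ → Q → List Q → Fin p → ℝ) (L : ℕ) (w : List Q) (j : Φ ⊕ Q × Fin m) :
    {v : List Q // v.length ≤ L} × Q × Fin p → ℝ :=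
  fun vqr => lssEntry S1 S2 j (w ++ vqr.1.1) vqr.2.1 vqr.2.2

/-- The column space of the sub-Hankel matrix `H_{Φ,L,M}`. -/
def hankelColSpan (S1 : Q → Q → Fin m → List Q → Fin p → ℝ)
    (S2 : Φ → Q → List Q → Fin p → ℝ) (L M : ℕ) :
    Submodule ℝ ({v : List Q // v.length ≤ L} × Q × Fin p → ℝ) :=
  Submodule.span ℝ
    (Set.range fun wj : {w : List Q // w.length ≤ M} × (Φ ⊕ Q × Fin m) =>
      hankelCol S1 S2 L wj.1.1 wj.2)

/-- Restriction of a column from the rows `|v| ≤ L + 1` to the rows `|v| ≤ L`. -/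
def rowRestrict (Q : Type*) (p L : ℕ) :
    ({v : List Q // v.length ≤ L + 1} × Q × Fin p → ℝ) →ₗ[ℝ]
      ({v : List Q // v.length ≤ L} × Q × Fin p → ℝ) :=
  LinearMap.funLeft ℝ ℝ fun vqr => (⟨vqr.1.1, vqr.1.2.trans (Nat.le_succ L)⟩, vqr.2)

/-- The shift sending a column `x` to the column `v ↦ x (q v)`. -/
def rowShift (p L : ℕ) (q : Q) :
    ({v : List Q // v.length ≤ L + 1} × Q × Fin p → ℝ) →ₗ[ℝ]
      ({v : List Q // v.length ≤ L} × Q × Fin p → ℝ) :=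
  LinearMap.funLeft ℝ ℝ fun vqr => (⟨q :: vqr.1.1, Nat.succ_le_succ vqr.1.2⟩, vqr.2)

variable (S1 : Q → Q → Fin m → List Q → Fin p → ℝ) (S2 : Φ → Q → List Q → Fin p → ℝ)

lemma rowRestrict_hankelCol (L : ℕ) (w : List Q) (j : Φ ⊕ Q × Fin m) :
    rowRestrict Q p L (hankelCol S1 S2 (L + 1) w j) = hankelCol S1 S2 L w j := rfl

lemma rowShift_hankelCol (L : ℕ) (q : Q) (w : List Q) (j : Φ ⊕ Q × Fin m) :
    rowShift p L q (hankelCol S1 S2 (L + 1) w j) = hankelCol S1 S2 L (w ++ [q]) j := by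
  ext vqr
  simp [rowShift, hankelCol, LinearMap.funLeft_apply]

lemma hankelCol_mem {L M : ℕ} {w : List Q} (hw : w.length ≤ M) (j : Φ ⊕ Q × Fin m) :
    hankelCol S1 S2 L w j ∈ hankelColSpan S1 S2 L M :=
  Submodule.subset_span ⟨(⟨w, hw⟩, j), rfl⟩

lemma hankelColSpan_mono (L : ℕ) {M M' : ℕ} (h : M ≤ M') :
    hankelColSpan S1 S2 L M ≤ hankelColSpan S1 S2 L M' := by
  refine Submodule.span_le.2 ?_
  rintro _ ⟨⟨w, j⟩, rfl⟩
  exact hankelCol_mem S1 S2 (w.2.trans h) j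

lemma map_rowRestrict_hankelColSpan (L M : ℕ) :
    (hankelColSpan S1 S2 (L + 1) M).map (rowRestrict Q p L) = hankelColSpan S1 S2 L M := by
  rw [hankelColSpan, Submodule.map_span, ← Set.range_comp]
  rfl

lemma map_rowShift_hankelColSpan_le (L M : ℕ) (q : Q) :
    (hankelColSpan S1 S2 (L + 1) M).map (rowShift p L q) ≤ hankelColSpan S1 S2 L (M + 1) := by
  rw [hankelColSpan, Submodule.map_span, Submodule.span_le]
  rintro _ ⟨_, ⟨⟨w, j⟩, rfl⟩, rfl⟩
  rw [rowShift_hankelCol]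
  exact hankelCol_mem S1 S2 (by simpa using w.2) j

lemma finite_row_index [Finite Q] (L : ℕ) :
    Finite ({v : List Q // v.length ≤ L} × Q × Fin p) := by
  have : Finite {v : List Q // v.length ≤ L} := (List.finite_length_le Q L).to_subtype
  infer_instance

variable {S1 S2}

/-- Under the rank condition, the shift of Hankel columns descends to the column space of
`H_{Φ,N,N}`. -/
lemma exists_shift_on_hankelColSpan [Finite Q] {N : ℕ}
    (h1 : lssHankelRank S1 S2 N N = lssHankelRank S1 S2 (N + 1) N)
    (h2 : lssHankelRank S1 S2 N N = lssHankelRank S1 S2 N (N + 1)) (q : Q) :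
    ∃ T : hankelColSpan S1 S2 N N →ₗ[ℝ] hankelColSpan S1 S2 N N,
      (∀ (w : List Q) (j : Φ ⊕ Q × Fin m) (hw : w.length ≤ N),
        (T ⟨_, hankelCol_mem S1 S2 hw j⟩).1 = hankelCol S1 S2 N (w ++ [q]) j) ∧
      ∀ (x : hankelColSpan S1 S2 N N) (v : List Q) (hv : (q :: v).length ≤ N) (i : Q × Fin p),
        (T x).1 (⟨v, (Nat.le_succ _).trans hv⟩, i) = x.1 (⟨q :: v, hv⟩, i) := by
  have := finite_row_index (Q := Q) (p := p) N
  have := finite_row_index (Q := Q) (p := p) (N + 1)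
  have heq : hankelColSpan S1 S2 N N = hankelColSpan S1 S2 N (N + 1) :=
    Submodule.eq_of_le_of_finrank_eq (hankelColSpan_mono S1 S2 N (Nat.le_succ N)) h2
  set W := hankelColSpan S1 S2 (N + 1) N with hW
  have hinj : LinearMap.ker ((rowRestrict Q p N).domRestrict W) = ⊥ := by
    have hr : LinearMap.range ((rowRestrict Q p N).domRestrict W) = hankelColSpan S1 S2 N N := by
      rw [LinearMap.range_domRestrict, map_rowRestrict_hankelColSpan]
    have hrank := LinearMap.finrank_range_add_finrank_ker ((rowRestrict Q p N).domRestrict W)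
    rw [hr] at hrank
    have h1' : Module.finrank ℝ (hankelColSpan S1 S2 N N) = Module.finrank ℝ W := h1
    exact Submodule.finrank_eq_zero.1 (by omega)
  obtain ⟨g, hg⟩ := LinearMap.exists_leftInverse_of_injective _ hinj
  have hgy : ∀ y (hy : y ∈ W), (g (rowRestrict Q p N y)).1 = y := fun y hy =>
    congrArg Subtype.val (LinearMap.congr_fun hg ⟨y, hy⟩)
  have hmaps : ∀ x ∈ hankelColSpan S1 S2 N N,
      (rowShift p N q ∘ₗ W.subtype ∘ₗ g) x ∈ hankelColSpan S1 S2 N N := by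
    intro x _
    rw [heq]
    exact map_rowShift_hankelColSpan_le S1 S2 N N q ⟨_, (g x).2, rfl⟩
  refine ⟨LinearMap.restrict _ hmaps, fun w j hw => ?_, fun x v hv i => ?_⟩
  · change rowShift p N q (g (hankelCol S1 S2 N w j)) = _
    rw [← rowRestrict_hankelCol, hgy _ (hankelCol_mem S1 S2 hw j), rowShift_hankelCol]
  · obtain ⟨x, hx⟩ := x
    rw [← map_rowRestrict_hankelColSpan] at hx
    obtain ⟨y, hy, rfl⟩ := hx
    change rowShift p N q (g (rowRestrict Q p N y)) _ = _
    rw [hgy y hy]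
    rfl

end HankelColumns

lemma wordProd_append {Q : Type*} {n : ℕ} (A : Q → Matrix (Fin n) (Fin n) ℝ) (u v : List Q) :
    wordProd A (u ++ v) = wordProd A v * wordProd A u := by
  induction u with
  | nil => simp [wordProd]
  | cons q u ih => simp [wordProd, ih, Matrix.mul_assoc]

/-- if `rank H_{Φ,N,N} = rank H_{Φ,N+1,N} = rank H_{Φ,N,N+1}` for some
`N > 0`, then there exists an LSS realization of dimension `rank H_{Φ,N,N}` which is a
`(2N+1)`-partial realization of the Markov-parameter data. -/
theorem stmt16 {Q Φ : Type*} [Fintype Q] {p m : ℕ}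
    (S1 : Q → Q → Fin m → List Q → Fin p → ℝ)
    (S2 : Φ → Q → List Q → Fin p → ℝ)
    (N : ℕ) (hN : 0 < N)
    (h1 : lssHankelRank S1 S2 N N = lssHankelRank S1 S2 (N + 1) N)
    (h2 : lssHankelRank S1 S2 N N = lssHankelRank S1 S2 N (N + 1)) :
    ∃ (A : Q → Matrix (Fin (lssHankelRank S1 S2 N N)) (Fin (lssHankelRank S1 S2 N N)) ℝ)
      (B : Q → Matrix (Fin (lssHankelRank S1 S2 N N)) (Fin m) ℝ)
      (C : Q → Matrix (Fin p) (Fin (lssHankelRank S1 S2 N N)) ℝ)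
      (μ : Φ → Fin (lssHankelRank S1 S2 N N) → ℝ),
      IsLssPartialRealization S1 S2 (2 * N + 1) A B C μ := by
  classical
  have := finite_row_index (Q := Q) (p := p) N
  choose T hTcol hTrow using exists_shift_on_hankelColSpan h1 h2
  let e : hankelColSpan S1 S2 N N ≃ₗ[ℝ] (Fin (lssHankelRank S1 S2 N N) → ℝ) :=
    (Module.finBasis ℝ (hankelColSpan S1 S2 N N)).equivFun
  let col (j : Φ ⊕ Q × Fin m) : hankelColSpan S1 S2 N N :=
    ⟨hankelCol S1 S2 N [] j, hankelCol_mem S1 S2 (Nat.zero_le N) j⟩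
  let out (q : Q) : hankelColSpan S1 S2 N N →ₗ[ℝ] (Fin p → ℝ) :=
    LinearMap.funLeft ℝ ℝ (fun r => (⟨[], Nat.zero_le N⟩, q, r)) ∘ₗ Submodule.subtype _
  let A (q : Q) := LinearMap.toMatrix' (e.toLinearMap ∘ₗ T q ∘ₗ e.symm.toLinearMap)
  let C (q : Q) := LinearMap.toMatrix' (out q ∘ₗ e.symm.toLinearMap)
  have hA (q : Q) (x) : A q *ᵥ e x = e (T q x) := by simp [A, LinearMap.toMatrix'_mulVec]
  have hC (q : Q) (x) : C q *ᵥ e x = out q x := by simp [C, LinearMap.toMatrix'_mulVec]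
  have hreach : ∀ (u : List Q) (j : Φ ⊕ Q × Fin m), u.length ≤ N + 1 →
      ∃ x : hankelColSpan S1 S2 N N,
        wordProd A u *ᵥ e (col j) = e x ∧ x.1 = hankelCol S1 S2 N u j := by
    intro u j
    induction u using List.reverseRecOn with
    | nil => exact fun _ => ⟨col j, by simp [wordProd], rfl⟩
    | append_singleton u q ih =>
      intro hu
      have hu' : u.length ≤ N := by simpa using hu
      obtain ⟨x, hx, hxu⟩ := ih (hu'.trans (Nat.le_succ N))
      obtain rfl : x = ⟨_, hankelCol_mem S1 S2 hu' j⟩ := Subtype.ext hxu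
      refine ⟨T q _, ?_, hTcol q u j hu'⟩
      rw [wordProd_append, ← Matrix.mulVec_mulVec, hx, ← hA]
      simp [wordProd]
  have hobs : ∀ (v : List Q) (hv : v.length ≤ N) (q : Q) (x : hankelColSpan S1 S2 N N) (r : Fin p),
      (C q *ᵥ (wordProd A v *ᵥ e x)) r = x.1 (⟨v, hv⟩, q, r) := by
    intro v
    induction v with
    | nil =>
      intro hv q x r
      rw [wordProd, Matrix.one_mulVec, hC]
      rfl
    | cons a v ih =>
      intro hv q x r
      rw [wordProd, ← Matrix.mulVec_mulVec, hA, ih ((Nat.le_succ _).trans hv), hTrow a x v hv]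
  have hmain : ∀ w : List Q, w.length ≤ 2 * N + 1 → ∀ (q : Q) (j : Φ ⊕ Q × Fin m) (r : Fin p),
      lssEntry S1 S2 j w q r = (C q *ᵥ (wordProd A w *ᵥ e (col j))) r := by
    intro w hw q j r
    have hsplit := List.take_append_drop (N + 1) w
    obtain ⟨x, hx, hxu⟩ := hreach (w.take (N + 1)) j (by simp)
    have hdrop : (w.drop (N + 1)).length ≤ N := by rw [List.length_drop]; omega
    conv_rhs => rw [← hsplit]
    rw [wordProd_append, ← Matrix.mulVec_mulVec, hx, hobs _ hdrop, hxu, hankelCol, hsplit]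
  refine ⟨A, fun q0 => Matrix.of fun i z => e (col (Sum.inr (q0, z))) i, C,
    fun f => e (col (Sum.inl f)), fun w hw => ⟨fun q q0 z => ?_, fun f q => ?_⟩⟩
  · exact funext fun r => hmain w hw q (Sum.inr (q0, z)) r
  · exact funext fun r => hmain w hw q (Sum.inl f) r
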